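/- Let B₀(Λ) be the (Λ+1)×(Λ+1) symmetric tridiagonal matrix with zero diagonal and entries c_l·A_l^{0,0} = √(1 + l²/k)·√(l²/(4l²−1)) for l = 1,…,Λ on the off-diagonals, with k ≥ Λ²(Λ+1)². Then its largest eigenvalue α₁(Λ;0) satisfies cos(π/(Λ+2)) < α₁(Λ;0) ≤ √(1 + (Λ(Λ+1)+1)/k), and hence α₁(Λ;0) → 1 as Λ → ∞; moreover α₁(Λ;0) ≥ 1 − π²/(2(Λ+2)²) for all Λ ≥ 2. -/

import Mathlib

/-- Off-diagonal entry `c_l A_l^{0,0} = √(1 + l²/k) √(l²/(4l²−1))`. -/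
noncomputable def f0 (k l : ℝ) : ℝ :=
  Real.sqrt (1 + l ^ 2 / k) * Real.sqrt (l ^ 2 / (4 * l ^ 2 - 1))

/-- The `(Λ+1) × (Λ+1)` matrix `B₀(Λ)` representing `x₃` on the `L₃ = 0` subspace of
the fuzzy sphere `S²_Λ`. -/
noncomputable def B0 (Λ : ℕ) (k : ℝ) : Matrix (Fin (Λ+1)) (Fin (Λ+1)) ℝ :=
  fun i j =>
    if (i : ℕ) + 1 = j then f0 k ((j : ℕ) : ℝ)
    else if (j : ℕ) + 1 = i then f0 k ((i : ℕ) : ℝ)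
    else 0

open Matrix in
/-- A strict Collatz–Wielandt lower bound: if `A` is symmetric and `c • x < A x` entrywise for a
positive vector `x`, then every upper bound of the eigenvalues of `A` exceeds `c`. -/
lemma Matrix.lt_of_forall_mul_lt_mulVec {n : Type*} [Fintype n] [DecidableEq n] [Nonempty n]
    {A : Matrix n n ℝ} (hA : A.IsHermitian) {α c : ℝ}
    (hα : ∀ μ, Module.End.HasEigenvalue (Matrix.toLin' A) μ → μ ≤ α)
    {x : n → ℝ} (hx : ∀ i, 0 < x i) (h : ∀ i, c * x i < (A *ᵥ x) i) : c < α := by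
  have hM : (α • (1 : Matrix n n ℝ) - A).IsHermitian := by
    apply Matrix.IsHermitian.sub _ hA
    simp [Matrix.IsHermitian]
  have hpsd : (α • (1 : Matrix n n ℝ) - A).PosSemidef := by
    rw [hM.posSemidef_iff_eigenvalues_nonneg]
    intro i
    have hv := hM.mulVec_eigenvectorBasis i
    set v : n → ℝ := (hM.eigenvectorBasis i).ofLp with hv_def
    have hne : v ≠ 0 := by
      intro h0
      exact hM.eigenvectorBasis.toBasis.ne_zero i (by
        rw [OrthonormalBasis.coe_toBasis]
        ext j
        exact congrFun h0 j)
    have hev : Module.End.HasEigenvalue (Matrix.toLin' A) (α - hM.eigenvalues i) := by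
      refine Module.End.hasEigenvalue_of_hasEigenvector (x := v) ⟨?_, hne⟩
      rw [Module.End.mem_eigenspace_iff, Matrix.toLin'_apply]
      rw [Matrix.sub_mulVec, Matrix.smul_mulVec, Matrix.one_mulVec] at hv
      rw [sub_smul, ← hv]
      abel
    simpa using hα _ hev
  have hq : 0 ≤ x ⬝ᵥ ((α • (1 : Matrix n n ℝ) - A) *ᵥ x) := by
    simpa using hpsd.dotProduct_mulVec_nonneg x
  by_contra! hle
  refine absurd hq (not_le.mpr ?_)
  rw [Matrix.sub_mulVec, Matrix.smul_mulVec, Matrix.one_mulVec]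
  refine Finset.sum_neg (fun i _ => mul_neg_of_pos_of_neg (hx i) ?_) Finset.univ_nonempty
  have := mul_le_mul_of_nonneg_right hle (hx i).le
  simp only [Pi.sub_apply, Pi.smul_apply, smul_eq_mul]
  linarith [h i]

open Matrix in
/-- The Collatz–Wielandt upper bound: if `A` has nonnegative entries and `A v ≤ C • v` entrywise
for a positive vector `v`, then every eigenvalue of `A` is at most `C`. -/
lemma Matrix.eigenvalue_le_of_forall_mulVec_le {n : Type*} [Fintype n] [DecidableEq n]
    {A : Matrix n n ℝ} (hA : ∀ i j, 0 ≤ A i j) {C : ℝ} {v : n → ℝ} (hv : ∀ i, 0 < v i)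
    (h : ∀ i, (A *ᵥ v) i ≤ C * v i) {μ : ℝ}
    (hμ : Module.End.HasEigenvalue (Matrix.toLin' A) μ) : μ ≤ C := by
  obtain ⟨w, hw, hw0⟩ := hμ.exists_hasEigenvector
  rw [Module.End.mem_eigenspace_iff, Matrix.toLin'_apply] at hw
  obtain ⟨j₀, hj₀⟩ := Function.ne_iff.mp hw0
  obtain ⟨i, -, hi⟩ := Finset.exists_max_image Finset.univ (fun i => |w i| / v i) ⟨j₀, by simp⟩
  have hle : ∀ j, |w j| ≤ |w i| / v i * v j := fun j =>
    (div_le_iff₀ (hv j)).mp (hi j (Finset.mem_univ j))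
  have hpos : 0 < |w i| := by
    have h1 : 0 < |w i| / v i * v j₀ := (abs_pos.mpr hj₀).trans_le (hle j₀)
    by_contra! h0
    have h2 : |w i| = 0 := le_antisymm h0 (abs_nonneg _)
    simp [h2] at h1
  have key : |μ| * |w i| ≤ C * |w i| := by
    calc |μ| * |w i| = |(A *ᵥ w) i| := by rw [hw]; simp [abs_mul]
      _ ≤ ∑ j, |A i j * w j| := Finset.abs_sum_le_sum_abs _ _
      _ ≤ ∑ j, |w i| / v i * (A i j * v j) := by
          refine Finset.sum_le_sum fun j _ => ?_
          rw [abs_mul, abs_of_nonneg (hA i j), mul_left_comm]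
          exact mul_le_mul_of_nonneg_left (hle j) (hA i j)
      _ = |w i| / v i * (A *ᵥ v) i := by rw [← Finset.mul_sum]; rfl
      _ ≤ |w i| / v i * (C * v i) :=
          mul_le_mul_of_nonneg_left (h i) (div_nonneg (abs_nonneg _) (hv i).le)
      _ = C * |w i| := by field_simp [(hv i).ne']
  exact (le_abs_self μ).trans (le_of_mul_le_mul_right key hpos)

lemma f0_nonneg (k l : ℝ) : 0 ≤ f0 k l := by unfold f0; positivity

@[simp] lemma f0_zero (k : ℝ) : f0 k 0 = 0 := by simp [f0]

lemma half_lt_f0 {k l : ℝ} (hk : 0 ≤ k) (hl : 1 ≤ l) : 1 / 2 < f0 k l := by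
  have hd : 0 < 4 * l ^ 2 - 1 := by nlinarith
  have h1 : 1 ≤ Real.sqrt (1 + l ^ 2 / k) := by
    rw [Real.one_le_sqrt]
    have : 0 ≤ l ^ 2 / k := by positivity
    linarith
  have h2 : 1 / 2 < Real.sqrt (l ^ 2 / (4 * l ^ 2 - 1)) := by
    apply Real.lt_sqrt_of_sq_lt
    rw [lt_div_iff₀ hd]
    linarith
  unfold f0
  nlinarith

lemma f0_le {k l L : ℝ} (hk : 0 ≤ k) (hl : 0 ≤ l) (hL : l ≤ L) :
    f0 k l ≤ Real.sqrt (1 + L ^ 2 / k) * Real.sqrt (l ^ 2 / (4 * l ^ 2 - 1)) := by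
  unfold f0
  gcongr

lemma B0_nonneg (Λ : ℕ) (k : ℝ) (i j : Fin (Λ + 1)) : 0 ≤ B0 Λ k i j := by
  unfold B0
  split_ifs
  exacts [f0_nonneg _ _, f0_nonneg _ _, le_rfl]

lemma B0_isHermitian (Λ : ℕ) (k : ℝ) : (B0 Λ k).IsHermitian := by
  ext i j
  simp only [Matrix.conjTranspose_apply, B0, star_trivial]
  split_ifs <;> first | rfl | omega

open Matrix in
lemma B0_mulVec (Λ : ℕ) (k : ℝ) (u : ℕ → ℝ) (i : Fin (Λ + 1)) :
    (B0 Λ k *ᵥ fun j => u j) i =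
      f0 k i * u (i - 1) + if (i : ℕ) < Λ then f0 k ((i : ℕ) + 1) * u (i + 1) else 0 := by
  obtain ⟨i, hi⟩ := i
  have hsplit : ∀ j : Fin (Λ + 1), B0 Λ k ⟨i, hi⟩ j * u j =
      (fun m : ℕ => (if m + 1 = i then f0 k i * u m else 0) +
        if i + 1 = m then f0 k m * u m else 0) j := by
    intro j
    simp only [B0]
    split_ifs <;> first | omega | simp
  simp only [Matrix.mulVec, dotProduct, hsplit]
  rw [Fin.sum_univ_eq_sum_range (fun m : ℕ => (if m + 1 = i then f0 k i * u m else 0) +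
        if i + 1 = m then f0 k m * u m else 0), Finset.sum_add_distrib]
  congr 1
  · cases i with
    | zero => simp
    | succ m =>
      simp only [add_left_inj, Finset.sum_ite_eq', Finset.mem_range, Nat.add_sub_cancel]
      rw [if_pos (by omega)]
  · rw [Finset.sum_ite_eq]
    simp

/-- The sine vector is a strict sub-eigenvector of `B0` for `cos (π / (Λ + 2))`. -/
lemma cos_lt_of_eigenvalue_le {Λ : ℕ} (hΛ : 0 < Λ) {k α : ℝ} (hk : 0 ≤ k)
    (hα : ∀ μ, Module.End.HasEigenvalue (Matrix.toLin' (B0 Λ k)) μ → μ ≤ α) :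
    Real.cos (Real.pi / ((Λ : ℝ) + 2)) < α := by
  set θ := Real.pi / ((Λ : ℝ) + 2) with hθ
  have hθ0 : 0 < θ := by positivity
  have hθπ : ((Λ : ℝ) + 2) * θ = Real.pi := by rw [hθ]; field_simp
  have hs : ∀ n : ℕ, 0 < n → n < Λ + 2 → 0 < Real.sin (n * θ) := by
    intro n hn hn'
    have h1 : (0 : ℝ) < n := by exact_mod_cast hn
    have h2 : (n : ℝ) < Λ + 2 := by exact_mod_cast hn'
    apply Real.sin_pos_of_pos_of_lt_pi (by positivity)
    rw [← hθπ]
    gcongr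
  refine Matrix.lt_of_forall_mul_lt_mulVec (B0_isHermitian Λ k) hα
    (x := fun j => (fun m : ℕ => Real.sin ((m + 1 : ℕ) * θ)) j)
    (fun j => hs _ (by omega) (by omega)) fun i => ?_
  rw [B0_mulVec Λ k (fun m : ℕ => Real.sin ((m + 1 : ℕ) * θ))]
  obtain ⟨i, hi⟩ := i
  dsimp only
  have hrec : Real.cos θ * Real.sin ((i + 1 : ℕ) * θ) =
      1 / 2 * Real.sin (i * θ) + 1 / 2 * Real.sin ((i + 2 : ℕ) * θ) := by
    have e1 : (i : ℝ) * θ = (i + 1 : ℕ) * θ - θ := by push_cast; ring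
    have e2 : ((i + 2 : ℕ) : ℝ) * θ = (i + 1 : ℕ) * θ + θ := by push_cast; ring
    rw [e1, e2, Real.sin_sub, Real.sin_add]
    ring
  rw [hrec]
  have hright : i < Λ → 1 / 2 * Real.sin ((i + 2 : ℕ) * θ) <
      f0 k ((i : ℝ) + 1) * Real.sin ((i + 2 : ℕ) * θ) := fun hiΛ =>
    mul_lt_mul_of_pos_right (half_lt_f0 hk (by simp)) (hs _ (by omega) (by omega))
  have hright' : 1 / 2 * Real.sin ((i + 2 : ℕ) * θ) ≤
      if i < Λ then f0 k ((i : ℝ) + 1) * Real.sin ((i + 1 + 1 : ℕ) * θ) else 0 := by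
    split_ifs with hiΛ
    · exact (hright hiΛ).le
    · obtain rfl : i = Λ := by omega
      push_cast
      rw [hθπ]
      simp
  rcases Nat.eq_zero_or_pos i with rfl | hipos
  · rw [if_pos hΛ]
    simpa using hright hΛ
  · refine add_lt_add_of_lt_of_le ?_ hright'
    rw [Nat.sub_add_cancel hipos]
    exact mul_lt_mul_of_pos_right (half_lt_f0 hk (by exact_mod_cast hipos))
      (hs _ hipos (by omega))

lemma sqrt_legendre_mul_left {l : ℝ} (hl : 1 ≤ l) :
    Real.sqrt (l ^ 2 / (4 * l ^ 2 - 1)) * Real.sqrt (2 * l - 1) = l / Real.sqrt (2 * l + 1) := by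
  rw [← Real.sqrt_mul' _ (by linarith)]
  have : l ^ 2 / (4 * l ^ 2 - 1) * (2 * l - 1) = l ^ 2 / (2 * l + 1) := by
    have h1 : 2 * l - 1 ≠ 0 := by linarith
    have h2 : 2 * l + 1 ≠ 0 := by linarith
    rw [show 4 * l ^ 2 - 1 = (2 * l - 1) * (2 * l + 1) by ring, div_mul_eq_mul_div,
      div_eq_div_iff (mul_ne_zero h1 h2) ‹_›]
    ring
  rw [this, Real.sqrt_div (sq_nonneg l), Real.sqrt_sq (by linarith)]

lemma sqrt_legendre_mul_right {l : ℝ} (hl : 1 ≤ l) :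
    Real.sqrt (l ^ 2 / (4 * l ^ 2 - 1)) * Real.sqrt (2 * l + 1) = l / Real.sqrt (2 * l - 1) := by
  rw [← Real.sqrt_mul' _ (by linarith)]
  have : l ^ 2 / (4 * l ^ 2 - 1) * (2 * l + 1) = l ^ 2 / (2 * l - 1) := by
    have h1 : 2 * l - 1 ≠ 0 := by linarith
    have h2 : 2 * l + 1 ≠ 0 := by linarith
    rw [show 4 * l ^ 2 - 1 = (2 * l - 1) * (2 * l + 1) by ring, div_mul_eq_mul_div,
      div_eq_div_iff (mul_ne_zero h1 h2) ‹_›]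
    ring
  rw [this, Real.sqrt_div (sq_nonneg l), Real.sqrt_sq (by linarith)]

/-- The vector of normalized Legendre polynomials at `1` is a super-eigenvector of `B0`. -/
lemma eigenvalue_B0_le {Λ : ℕ} {k μ : ℝ} (hk : 0 ≤ k)
    (hμ : Module.End.HasEigenvalue (Matrix.toLin' (B0 Λ k)) μ) :
    μ ≤ Real.sqrt (1 + (Λ : ℝ) ^ 2 / k) := by
  refine Matrix.eigenvalue_le_of_forall_mulVec_le (B0_nonneg Λ k)
    (v := fun j => (fun m : ℕ => Real.sqrt (2 * m + 1)) j)
    (fun j => Real.sqrt_pos.mpr (by positivity)) (fun i => ?_) hμ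
  rw [B0_mulVec Λ k (fun m : ℕ => Real.sqrt (2 * m + 1))]
  obtain ⟨i, hi⟩ := i
  dsimp only
  set C := Real.sqrt (1 + (Λ : ℝ) ^ 2 / k)
  have hC : 0 ≤ C := Real.sqrt_nonneg _
  have hleft : f0 k i * Real.sqrt (2 * (i - 1 : ℕ) + 1) ≤ C * (i / Real.sqrt (2 * i + 1)) := by
    rcases Nat.eq_zero_or_pos i with rfl | hipos
    · simp
    · have h1 : (1 : ℝ) ≤ i := by exact_mod_cast hipos
      have h2 : (i : ℝ) ≤ Λ := by exact_mod_cast Nat.lt_succ_iff.mp hi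
      rw [← sqrt_legendre_mul_left h1, ← mul_assoc,
        show 2 * ((i - 1 : ℕ) : ℝ) + 1 = 2 * i - 1 by push_cast [hipos]; ring]
      gcongr
      exact f0_le hk (by linarith) h2
  have hright : (if i < Λ then f0 k ((i : ℝ) + 1) * Real.sqrt (2 * (i + 1 : ℕ) + 1) else 0) ≤
      C * ((i + 1) / Real.sqrt (2 * i + 1)) := by
    split_ifs with hiΛ
    · have h1 : (1 : ℝ) ≤ i + 1 := by simp
      have h2 : (i : ℝ) + 1 ≤ Λ := by exact_mod_cast hiΛ
      have h3 := sqrt_legendre_mul_right h1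
      rw [show 2 * ((i : ℝ) + 1) - 1 = 2 * i + 1 by ring] at h3
      rw [← h3, ← mul_assoc]
      push_cast
      gcongr
      exact f0_le hk (by linarith) h2
    · positivity
  refine (add_le_add hleft hright).trans_eq ?_
  rw [← mul_add, ← add_div, show (i : ℝ) + (i + 1) = 2 * i + 1 by ring, Real.div_sqrt]

theorem stmt_17 (k : ℕ → ℝ) (hk : ∀ Λ : ℕ, (Λ : ℝ)^2 * ((Λ : ℝ) + 1)^2 ≤ k Λ)
    (α₁ : ℕ → ℝ)
    (hα₁ : ∀ Λ : ℕ, 0 < Λ →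
      IsGreatest {α : ℝ | Module.End.HasEigenvalue (Matrix.toLin' (B0 Λ (k Λ))) α} (α₁ Λ)) :
    (∀ Λ : ℕ, 0 < Λ →
        Real.cos (Real.pi / ((Λ : ℝ) + 2)) < α₁ Λ ∧
          α₁ Λ ≤ Real.sqrt (1 + ((Λ : ℝ) * ((Λ : ℝ) + 1) + 1) / k Λ)) ∧
      Filter.Tendsto α₁ Filter.atTop (nhds 1) ∧
      ∀ Λ : ℕ, 2 ≤ Λ → 1 - Real.pi ^ 2 / (2 * ((Λ : ℝ) + 2) ^ 2) ≤ α₁ Λ := by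
  have hkpos : ∀ Λ : ℕ, 0 < Λ → 0 < k Λ := fun Λ hΛ => by
    have h1 : (0 : ℝ) < Λ := by exact_mod_cast hΛ
    exact lt_of_lt_of_le (by positivity) (hk Λ)
  have hlow : ∀ Λ : ℕ, 0 < Λ → Real.cos (Real.pi / ((Λ : ℝ) + 2)) < α₁ Λ := fun Λ hΛ =>
    cos_lt_of_eigenvalue_le hΛ (hkpos Λ hΛ).le fun μ hμ => (hα₁ Λ hΛ).2 hμ
  have hup : ∀ Λ : ℕ, 0 < Λ → α₁ Λ ≤ Real.sqrt (1 + (Λ : ℝ) ^ 2 / k Λ) := fun Λ hΛ =>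
    eigenvalue_B0_le (hkpos Λ hΛ).le (hα₁ Λ hΛ).1
  refine ⟨fun Λ hΛ => ⟨hlow Λ hΛ, (hup Λ hΛ).trans (Real.sqrt_le_sqrt ?_)⟩, ?_, fun Λ hΛ => ?_⟩
  · have := (hkpos Λ hΛ).le
    have h1 : (0 : ℝ) ≤ Λ := Nat.cast_nonneg Λ
    gcongr
    linarith
  · have hL : Filter.Tendsto (fun Λ : ℕ => Real.cos (Real.pi / ((Λ : ℝ) + 2)))
        Filter.atTop (nhds 1) := by
      have h0 : Filter.Tendsto (fun Λ : ℕ => Real.pi / ((Λ : ℝ) + 2)) Filter.atTop (nhds 0) :=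
        tendsto_const_nhds.div_atTop
          (Filter.tendsto_atTop_add_const_right _ _ tendsto_natCast_atTop_atTop)
      simpa [Function.comp_def] using (Real.continuous_cos.tendsto 0).comp h0
    have hU : Filter.Tendsto (fun Λ : ℕ => Real.sqrt (1 + 1 / (Λ : ℝ)))
        Filter.atTop (nhds 1) := by
      have h0 := (tendsto_one_div_atTop_nhds_zero_nat (𝕜 := ℝ)).const_add 1
      simpa using h0.sqrt
    refine tendsto_of_tendsto_of_tendsto_of_le_of_le' hL hU ?_ ?_
    · filter_upwards [Filter.eventually_gt_atTop 0] with Λ hΛ using (hlow Λ hΛ).le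
    · filter_upwards [Filter.eventually_gt_atTop 0] with Λ hΛ
      refine (hup Λ hΛ).trans (Real.sqrt_le_sqrt ?_)
      have h1 : (1 : ℝ) ≤ Λ := by exact_mod_cast hΛ
      gcongr 1 + ?_
      rw [div_le_div_iff₀ (hkpos Λ hΛ) (by linarith), one_mul]
      refine le_trans ?_ (hk Λ)
      gcongr
      nlinarith
  · refine le_trans ?_ (hlow Λ (by omega)).le
    refine le_trans (le_of_eq ?_) (Real.one_sub_sq_div_two_le_cos)
    field_simp
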